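/- Let (N_n)_{n≥0} be a discrete-time martingale with N_0 = 0 whose increments are bounded in absolute value by A > 0, and let ⟨N⟩_n := Σ_{k=1}^n 𝔼[(N_k − N_{k−1})² | F_{k−1}] be its predictable bracket. For v > 0 let T_v be the first time n at which N_n ≥ v. Then for any a > 0, ℙ[⟨N⟩_{T_v} ≤ a and T_v < ∞] ≤ exp(−(v/(A+1))·(log(v/(a(A+1))) − 1)). -/

import Mathlib

open MeasureTheory ProbabilityTheory Filter Topology
open scoped ENNReal NNReal

/-- The predictable bracket `⟨N⟩_n = Σ_{k=1}^n 𝔼[(N_k − N_{k−1})² | F_{k−1}]` of a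
discrete-time process `N`. -/
noncomputable def predictableBracket {Ω : Type*} {m : MeasurableSpace Ω}
    (P : Measure Ω) (ℱ : MeasureTheory.Filtration ℕ m) (N : ℕ → Ω → ℝ) (n : ℕ) (ω : Ω) : ℝ :=
  ∑ k ∈ Finset.range n, (P[fun ω' => (N (k + 1) ω' - N k ω') ^ 2|ℱ k]) ω

lemma aux_exp_bound (x y : ℝ) (h : |x| ≤ y) :
    Real.exp x ≤ 1 + x + x ^ 2 * Real.exp y := by
  have h1 := Complex.norm_exp_sub_sum_le_norm_mul_exp (x : ℂ) 2
  have h2 : Complex.exp (x : ℂ) - ∑ m ∈ Finset.range 2, (x : ℂ) ^ m / (m.factorial : ℂ)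
      = ((Real.exp x - (1 + x) : ℝ) : ℂ) := by
    simp [Finset.sum_range_succ]
  rw [h2, Complex.norm_real, Complex.norm_real, Real.norm_eq_abs, Real.norm_eq_abs, sq_abs] at h1
  have h3 : Real.exp |x| ≤ Real.exp y := Real.exp_le_exp.2 h
  have h4 := le_abs_self (Real.exp x - (1 + x))
  nlinarith [mul_le_mul_of_nonneg_left h3 (sq_nonneg x)]

lemma aux_sq_le_exp (l : ℝ) (hl : 0 ≤ l) : l ^ 2 ≤ Real.exp l := by
  have h1 := Real.add_one_le_exp (l / 4)
  have h2 : Real.exp l = Real.exp (l / 4) ^ 4 := by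
    rw [← Real.exp_nat_mul]; congr 1; push_cast; ring
  have h3 : l ≤ Real.exp (l / 4) ^ 2 := by
    nlinarith [sq_nonneg (1 - l / 4)]
  rw [h2]
  calc l ^ 2 ≤ (Real.exp (l / 4) ^ 2) ^ 2 := by gcongr
    _ = _ := by ring

lemma aux_split {Ω : Type*} {m : MeasurableSpace Ω} (P : Measure Ω) [IsProbabilityMeasure P]
    (f : Ω → ℝ) (hf : Integrable f P) (K : ℝ) (S G : Set Ω) (hS : MeasurableSet S)
    (hG : MeasurableSet G) (hGf : ∀ ω ∈ G, K ≤ f ω) :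
    K * P.real (S ∩ G) + ∫ ω in S \ G, f ω ∂P ≤ ∫ ω in S, f ω ∂P := by
  have h1 := integral_inter_add_diff (s := S) hG (μ := P) hf.integrableOn
  have h2 : K * P.real (S ∩ G) ≤ ∫ ω in S ∩ G, f ω ∂P := by
    have := setIntegral_mono_on (μ := P) (s := S ∩ G) (f := fun _ => K) (g := f)
      (integrable_const K).integrableOn hf.integrableOn (hS.inter hG) (fun ω hω => hGf ω hω.2)
    rw [setIntegral_const, smul_eq_mul] at this
    linarith
  linarith

lemma aux_ville {Ω : Type*} {m : MeasurableSpace Ω} (P : Measure Ω) [IsProbabilityMeasure P]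
    (ℱ : Filtration ℕ m) (Z : ℕ → Ω → ℝ) (hZ : Supermartingale Z ℱ P) (K : ℝ) (n : ℕ) :
    K * P.real {ω | ∃ k ≤ n, K ≤ Z k ω} + ∫ ω in {ω | ∃ k ≤ n, K ≤ Z k ω}ᶜ, Z n ω ∂P
      ≤ ∫ ω, Z 0 ω ∂P := by
  have hGm : ∀ k, MeasurableSet[ℱ k] {ω | K ≤ Z k ω} := fun k =>
    (hZ.1 k).measurable measurableSet_Ici
  have hEm : ∀ n, MeasurableSet[ℱ n] {ω | ∃ k ≤ n, K ≤ Z k ω} := by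
    intro n
    have : {ω | ∃ k ≤ n, K ≤ Z k ω} = ⋃ k ∈ Finset.range (n + 1), {ω | K ≤ Z k ω} := by
      ext ω; simp [Nat.lt_succ_iff]
    rw [this]
    refine Finset.measurableSet_biUnion _ (fun k hk => ?_)
    exact ℱ.mono (Nat.lt_succ_iff.1 (Finset.mem_range.1 hk)) _ (hGm k)
  induction n with
  | zero =>
    have h := aux_split P (Z 0) (hZ.2.2 0) K Set.univ {ω | K ≤ Z 0 ω} MeasurableSet.univ
      (ℱ.le 0 _ (hGm 0)) (fun ω h => h)
    simpa [Set.compl_eq_univ_diff] using h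
  | succ n ih =>
    have h := aux_split P (Z (n+1)) (hZ.2.2 (n+1)) K {ω | ∃ k ≤ n, K ≤ Z k ω}ᶜ {ω | K ≤ Z (n+1) ω}
      (ℱ.le n _ (hEm n)).compl (ℱ.le (n+1) _ (hGm (n+1))) (fun ω h => h)
    have h2 := hZ.setIntegral_le (Nat.le_succ n) (hEm n).compl
    have h3 : {ω | ∃ k ≤ n + 1, K ≤ Z k ω} = {ω | ∃ k ≤ n, K ≤ Z k ω} ∪
        ({ω | ∃ k ≤ n, K ≤ Z k ω}ᶜ ∩ {ω | K ≤ Z (n+1) ω}) := by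
      rw [Set.union_inter_distrib_left, Set.union_compl_self, Set.univ_inter]
      ext ω
      simp only [Set.mem_setOf_eq, Set.mem_union]
      constructor
      · rintro ⟨k, hk, h⟩
        rcases Nat.lt_or_eq_of_le hk with h' | rfl
        · exact Or.inl ⟨k, Nat.lt_succ_iff.1 h', h⟩
        · exact Or.inr h
      · rintro (⟨k, hk, h⟩ | h)
        · exact ⟨k, by omega, h⟩
        · exact ⟨n+1, le_rfl, h⟩
    have h4 : {ω | ∃ k ≤ n + 1, K ≤ Z k ω}ᶜ =
        {ω | ∃ k ≤ n, K ≤ Z k ω}ᶜ \ {ω | K ≤ Z (n+1) ω} := by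
      rw [h3, Set.union_inter_distrib_left, Set.union_compl_self, Set.univ_inter,
        Set.compl_union, Set.diff_eq]
    have h5 : P.real {ω | ∃ k ≤ n + 1, K ≤ Z k ω} = P.real {ω | ∃ k ≤ n, K ≤ Z k ω} +
        P.real ({ω | ∃ k ≤ n, K ≤ Z k ω}ᶜ ∩ {ω | K ≤ Z (n+1) ω}) := by
      rw [h3]
      refine measureReal_union ?_ ((ℱ.le n _ (hEm n)).compl.inter (ℱ.le (n+1) _ (hGm (n+1))))
      exact Set.disjoint_left.2 (fun ω h1 h2 => h2.1 h1)
    rw [h4, h5]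
    linarith

lemma aux_ville_sup {Ω : Type*} {m : MeasurableSpace Ω} (P : Measure Ω) [IsProbabilityMeasure P]
    (ℱ : Filtration ℕ m) (Z : ℕ → Ω → ℝ) (hZ : Supermartingale Z ℱ P) (hpos : ∀ n ω, 0 ≤ Z n ω)
    (h0 : ∀ ω, Z 0 ω = 1) (K : ℝ) (hK : 0 < K) :
    P {ω | ∃ k, K ≤ Z k ω} ≤ ENNReal.ofReal K⁻¹ := by
  have hU : {ω | ∃ k, K ≤ Z k ω} = ⋃ n : ℕ, {ω | ∃ k ≤ n, K ≤ Z k ω} := by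
    ext ω; simp only [Set.mem_setOf_eq, Set.mem_iUnion]
    exact ⟨fun ⟨k, h⟩ => ⟨k, k, le_rfl, h⟩, fun ⟨_, k, _, h⟩ => ⟨k, h⟩⟩
  have hmono : Monotone (fun n : ℕ => {ω | ∃ k ≤ n, K ≤ Z k ω}) :=
    fun i j hij ω ⟨k, hk, h⟩ => ⟨k, hk.trans hij, h⟩
  rw [hU, hmono.measure_iUnion]
  refine iSup_le (fun n => ?_)
  have h := aux_ville P ℱ Z hZ K n
  have h1 : 0 ≤ ∫ ω in {ω | ∃ k ≤ n, K ≤ Z k ω}ᶜ, Z n ω ∂P := integral_nonneg (hpos n)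
  have h2 : ∫ ω, Z 0 ω ∂P = 1 := by simp [h0]
  rw [← ofReal_measureReal]
  apply ENNReal.ofReal_le_ofReal
  rw [← one_div, le_div_iff₀ hK]
  linarith

lemma aux_super {Ω : Type*} {m : MeasurableSpace Ω} (P : Measure Ω) [IsProbabilityMeasure P]
    (ℱ : Filtration ℕ m)
    (N : ℕ → Ω → ℝ) (hN : Martingale N ℱ P)
    (hN0 : ∀ ω, N 0 ω = 0)
    (A : ℝ) (hA : 0 < A)
    (hbdd : ∀ n : ℕ, ∀ᵐ ω ∂P, |N (n + 1) ω - N n ω| ≤ A) (l : ℝ) (hl : 0 ≤ l) :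
    Supermartingale (fun n ω => Real.exp (l * N n ω -
      Real.exp (l * (A + 1)) * predictableBracket P ℱ N n ω)) ℱ P := by
  set c := Real.exp (l * (A + 1)) with hc
  have hcpos : 0 < c := Real.exp_pos _
  have hV0 : ∀ k, 0 ≤ᵐ[P] P[fun ω' => (N (k + 1) ω' - N k ω') ^ 2|ℱ k] := fun k =>
    condExp_nonneg (Eventually.of_forall fun ω => sq_nonneg _)
  have hBsucc : ∀ n ω, predictableBracket P ℱ N (n+1) ω = predictableBracket P ℱ N n ω +
      (P[fun ω' => (N (n + 1) ω' - N n ω') ^ 2|ℱ n]) ω := fun n ω => by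
    simp [predictableBracket, Finset.sum_range_succ]
  have hB0 : ∀ n, ∀ᵐ ω ∂P, 0 ≤ predictableBracket P ℱ N n ω := by
    intro n
    filter_upwards [ae_all_iff.2 hV0] with ω h
    exact Finset.sum_nonneg fun k _ => h k
  have hBm : ∀ n, StronglyMeasurable[ℱ n] (predictableBracket P ℱ N (n+1)) := by
    intro n
    have : predictableBracket P ℱ N (n+1) = ∑ k ∈ Finset.range (n+1),
      (P[fun ω' => (N (k + 1) ω' - N k ω') ^ 2|ℱ k]) := by
      ext ω; simp [predictableBracket]
    rw [this]
    refine Finset.stronglyMeasurable_sum _ (fun k hk => ?_)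
    exact stronglyMeasurable_condExp.mono (ℱ.mono (Nat.lt_succ_iff.1 (Finset.mem_range.1 hk)))
  have hBm' : ∀ n, StronglyMeasurable[ℱ n] (predictableBracket P ℱ N n) := by
    intro n
    cases n with
    | zero =>
      have : predictableBracket P ℱ N 0 = fun _ => 0 := by ext ω; simp [predictableBracket]
      rw [this]; exact stronglyMeasurable_const
    | succ n => exact (hBm n).mono (ℱ.mono (Nat.le_succ n))
  have hNb : ∀ n : ℕ, ∀ᵐ ω ∂P, N n ω ≤ n * A := by
    intro n
    filter_upwards [ae_all_iff.2 hbdd] with ω h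
    induction n with
    | zero => simp [hN0]
    | succ n ih =>
      have := (abs_le.1 (h n)).2
      push_cast; linarith
  have hadp : StronglyAdapted ℱ (fun n ω => Real.exp (l * N n ω -
      c * predictableBracket P ℱ N n ω)) := fun n =>
    Real.continuous_exp.comp_stronglyMeasurable
      (((hN.1 n).const_mul l).sub ((hBm' n).const_mul c))
  have hint : ∀ n, Integrable (fun ω => Real.exp (l * N n ω -
      c * predictableBracket P ℱ N n ω)) P := by
    intro n
    refine Integrable.of_bound ((hadp n).mono (ℱ.le n)).aestronglyMeasurable
      (Real.exp (l * (n * A))) ?_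
    filter_upwards [hNb n, hB0 n] with ω h1 h2
    rw [Real.norm_eq_abs, abs_of_pos (Real.exp_pos _), Real.exp_le_exp]
    nlinarith [mul_le_mul_of_nonneg_left h1 hl, mul_nonneg hcpos.le h2]
  refine supermartingale_nat hadp hint (fun n => ?_)
  set D : Ω → ℝ := fun ω => N (n+1) ω - N n ω with hD
  set V := P[fun ω' => (N (n + 1) ω' - N n ω') ^ 2|ℱ n] with hV
  set f : Ω → ℝ := fun ω => Real.exp (l * N n ω - c * predictableBracket P ℱ N (n+1) ω) with hf
  set g : Ω → ℝ := fun ω => Real.exp (l * D ω) with hg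
  have hfg : (fun ω => Real.exp (l * N (n+1) ω - c * predictableBracket P ℱ N (n+1) ω)) = f * g := by
    ext ω
    simp only [hf, hg, hD, Pi.mul_apply, ← Real.exp_add]
    congr 1; ring
  have hDint : Integrable D P := (hN.integrable _).sub (hN.integrable _)
  have hDm : AEStronglyMeasurable D P := hDint.aestronglyMeasurable
  have hD2int : Integrable (fun ω => D ω ^ 2) P := by
    refine Integrable.of_bound (hDm.pow 2) (A ^ 2) ?_
    filter_upwards [hbdd n] with ω h
    rw [Real.norm_eq_abs, abs_of_nonneg (sq_nonneg _), ← sq_abs]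
    gcongr
  have hgint : Integrable g P := by
    refine Integrable.of_bound (Real.continuous_exp.comp_aestronglyMeasurable (hDm.const_mul l))
      (Real.exp (l * A)) ?_
    filter_upwards [hbdd n] with ω h
    rw [Real.norm_eq_abs, abs_of_pos (Real.exp_pos _), Real.exp_le_exp]
    exact mul_le_mul_of_nonneg_left (abs_le.1 h).2 hl
  have hfm : StronglyMeasurable[ℱ n] f := Real.continuous_exp.comp_stronglyMeasurable
      (((hN.1 n).const_mul l).sub ((hBm n).const_mul c))
  have hpull : P[f * g|ℱ n] =ᵐ[P] f * P[g|ℱ n] :=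
    condExp_mul_of_stronglyMeasurable_left hfm (hfg ▸ hint (n+1)) hgint
  have hDc : P[D|ℱ n] =ᵐ[P] 0 := by
    have h1 : P[D|ℱ n] =ᵐ[P] P[N (n+1)|ℱ n] - P[N n|ℱ n] :=
      condExp_sub (hN.integrable _) (hN.integrable _) _
    filter_upwards [h1, hN.2 n (n+1) (Nat.le_succ n), hN.2 n n le_rfl] with ω h1 h2 h3
    rw [h1, Pi.sub_apply, h2, h3]; simp
  set κ := l ^ 2 * Real.exp (l * A) with hκ
  have hκc : κ ≤ c := by
    rw [hκ, hc, show l * (A + 1) = l + l * A by ring, Real.exp_add]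
    exact mul_le_mul_of_nonneg_right (aux_sq_le_exp l hl) (Real.exp_pos _).le
  have hgle : g ≤ᵐ[P] (fun _ => (1:ℝ)) + (l • D + κ • (fun ω => D ω ^ 2)) := by
    filter_upwards [hbdd n] with ω h
    have := aux_exp_bound (l * D ω) (l * A) (by
      rw [abs_mul, abs_of_nonneg hl]; exact mul_le_mul_of_nonneg_left h hl)
    simp only [Pi.add_apply, Pi.smul_apply, smul_eq_mul, hg, hκ]
    linarith [show (l * D ω) ^ 2 * Real.exp (l * A) = l ^ 2 * Real.exp (l * A) * D ω ^ 2 by ring]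
  have i1 : Integrable (l • D) P := hDint.smul l
  have i2 : Integrable (κ • (fun ω => D ω ^ 2)) P := hD2int.smul κ
  have hc1 := condExp_mono (m := ℱ n) hgint ((integrable_const (1:ℝ)).add (i1.add i2)) hgle
  have hc2 := condExp_add (integrable_const (1:ℝ)) (i1.add i2) (ℱ n)
  have hc3 := condExp_add i1 i2 (ℱ n)
  have hc4 := condExp_smul (μ := P) l D (ℱ n)
  have hc5 := condExp_smul (μ := P) κ (fun ω => D ω ^ 2) (ℱ n)
  have hc6 : P[(fun _ : Ω => (1:ℝ))|ℱ n] = fun _ => 1 := condExp_const (ℱ.le n) 1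
  rw [hfg]
  filter_upwards [hpull, hDc, hc1, hc2, hc3, hc4, hc5, hV0 n] with ω h0 hd h1 h2 h3 h4 h5 hv
  rw [h0, Pi.mul_apply]
  rw [h2, Pi.add_apply, h3, Pi.add_apply, h4, h5, hc6, Pi.smul_apply, Pi.smul_apply, hd] at h1
  simp only [Pi.zero_apply, smul_eq_mul, mul_zero, zero_add] at h1
  have h6 : (P[g|ℱ n]) ω ≤ Real.exp (c * V ω) := by
    refine h1.trans ?_
    have e1 := Real.add_one_le_exp (c * V ω)
    have e2 : κ * V ω ≤ c * V ω := mul_le_mul_of_nonneg_right hκc hv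
    change 1 + κ * V ω ≤ _
    linarith
  calc f ω * (P[g|ℱ n]) ω ≤ f ω * Real.exp (c * V ω) :=
        mul_le_mul_of_nonneg_left h6 (Real.exp_pos _).le
    _ = Real.exp (l * N n ω - c * predictableBracket P ℱ N n ω) := by
        simp only [hf, ← Real.exp_add, hBsucc]
        congr 1; ring

/-- Let `(N_n)` be a discrete-time martingale with `N_0 = 0` and increments
bounded in absolute value by `A > 0`, and let `⟨N⟩` be its predictable bracket. For `v > 0`
let `T_v` be the first time `N_n ≥ v`. Then for any `a > 0`,
`ℙ[⟨N⟩_{T_v} ≤ a, T_v < ∞] ≤ exp (−(v/(A+1)) (log (v/(a(A+1))) − 1))`. -/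
theorem discrete_martingale_bracket_hitting_bound
    {Ω : Type*} {m : MeasurableSpace Ω} (P : Measure Ω) [IsProbabilityMeasure P]
    (ℱ : Filtration ℕ m)
    (N : ℕ → Ω → ℝ) (hN : Martingale N ℱ P)
    (hN0 : ∀ ω, N 0 ω = 0)
    (A : ℝ) (hA : 0 < A)
    (hbdd : ∀ n : ℕ, ∀ᵐ ω ∂P, |N (n + 1) ω - N n ω| ≤ A)
    (v : ℝ) (hv : 0 < v) (a : ℝ) (ha : 0 < a) :
    P {ω | (∃ n : ℕ, v ≤ N n ω) ∧
        predictableBracket P ℱ N (sInf {n : ℕ | v ≤ N n ω}) ω ≤ a} ≤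
      ENNReal.ofReal
        (Real.exp (-(v / (A + 1)) * (Real.log (v / (a * (A + 1))) - 1))) := by
  have hB : 0 < A + 1 := by linarith
  set L := Real.log (v / (a * (A + 1))) with hL
  by_cases h : L ≤ 1
  · refine prob_le_one.trans ?_
    rw [← ENNReal.ofReal_one]
    apply ENNReal.ofReal_le_ofReal
    rw [Real.one_le_exp_iff]
    have : 0 < v / (A + 1) := by positivity
    nlinarith
  · push Not at h
    set l := L / (A + 1) with hl
    have hl0 : 0 ≤ l := by positivity
    have hlB : l * (A + 1) = L := by rw [hl]; field_simp
    have hexp : Real.exp (l * (A + 1)) = v / (a * (A + 1)) := by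
      rw [hlB, hL, Real.exp_log (by positivity)]
    have hs := aux_super P ℱ N hN hN0 A hA hbdd l hl0
    have hV := aux_ville_sup P ℱ _ hs (fun n ω => (Real.exp_pos _).le)
      (fun ω => by simp [hN0, predictableBracket]) (Real.exp (v / (A + 1) * (L - 1)))
      (Real.exp_pos _)
    rw [← Real.exp_neg, ← neg_mul] at hV
    refine (measure_mono ?_).trans hV
    rintro ω ⟨hne, hbr⟩
    refine ⟨sInf {n : ℕ | v ≤ N n ω}, ?_⟩
    have hmem : v ≤ N (sInf {n : ℕ | v ≤ N n ω}) ω := Nat.sInf_mem (s := {n : ℕ | v ≤ N n ω}) hne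
    rw [Real.exp_le_exp]
    have e1 := mul_le_mul_of_nonneg_left hmem hl0
    have e2 := mul_le_mul_of_nonneg_left hbr (Real.exp_pos (l * (A + 1))).le
    have e3 : Real.exp (l * (A + 1)) * a = v / (A + 1) := by rw [hexp]; field_simp
    have e4 : v / (A + 1) * (L - 1) = l * v - v / (A + 1) := by rw [hl]; field_simp
    rw [e4]; linarith
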